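/- Let n ≥ 3 be an integer, p_1,…,p_q positive integers with Σ_j p_j = (n−1)T, and K ≥ 1 a real number; set α = (2K + n − 1)/(Kn + K). Consider the instance with n agents and items o_1,…,o_{q+2}, where for each agent i ∈ {1,…,n−1}: c_i(o_j) = p_j/K for 1 ≤ j ≤ q and c_i(o_{q+1}) = c_i(o_{q+2}) = T; and for agent n: c_n(o_j) = α·p_j for 1 ≤ j ≤ q and c_n(o_{q+1}) = c_n(o_{q+2}) = α·T (so each agent's total cost is ((n−1)/K + 2)·T). Then: (a) if {1,…,q} can be partitioned into I₁,…,I_{n−1} with Σ_{j∈I_i} p_j = T for every i, then the allocation A_i = {o_j : j ∈ I_i} for i ≤ n−1 and A_n = {o_{q+1}, o_{q+2}} is EF1 and has social cost (n−1)T/K + 2αT, which equals the minimum social cost over all allocations; and (b) if no such partition exists, then every EF1 allocation of this instance has social cost at least (n−1)T/K + αT + T. -/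

import Mathlib

open Finset

/-- `A` is an allocation: the bundles are pairwise disjoint and every item is assigned. -/
def IsAllocation {n : ℕ} {ι : Type*} (A : Fin n → Finset ι) : Prop :=
  (∀ i j : Fin n, i ≠ j → Disjoint (A i) (A j)) ∧ ∀ o : ι, ∃ i : Fin n, o ∈ A i

/-- The social cost of an allocation. -/
def SC {n : ℕ} {ι : Type*} (c : Fin n → ι → ℝ) (A : Fin n → Finset ι) : ℝ :=
  ∑ i, ∑ o ∈ A i, c i o

/-- Envy-freeness up to one item (for chores). -/
def EF1 {n : ℕ} {ι : Type*} [DecidableEq ι] (c : Fin n → ι → ℝ)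
    (A : Fin n → Finset ι) : Prop :=
  ∀ i j : Fin n, ∃ S ⊆ A i, S.card ≤ 1 ∧ ∑ o ∈ A i \ S, c i o ≤ ∑ o ∈ A j, c i o

/-- Items are `Fin q ⊕ Fin 2`: `Sum.inl j` is `o_{j+1}` (`j < q`) and the two right items are
`o_{q+1}, o_{q+2}`.  Agents `1,…,n-1` (indices `< n-1`) have cost `p_j/K` on `o_j` and cost
`T` on each of `o_{q+1}, o_{q+2}`; agent `n` (index `n-1`) has cost `α·p_j` on `o_j` and
`α·T` on each of `o_{q+1}, o_{q+2}`, where `α = (2K+n-1)/(Kn+K)`. -/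
noncomputable def cEF1H (n q T : ℕ) (p : Fin q → ℕ) (K : ℝ) (i : Fin n) :
    Fin q ⊕ Fin 2 → ℝ := fun o =>
  match o with
  | Sum.inl j =>
      if (i : ℕ) = n - 1 then (2 * K + n - 1) / (K * n + K) * p j else (p j : ℝ) / K
  | Sum.inr _ =>
      if (i : ℕ) = n - 1 then (2 * K + n - 1) / (K * n + K) * T else (T : ℝ)

/-- An allocation is the family of fibres of the map sending an item to its owner. -/
theorem IsAllocation.exists_owner {n : ℕ} {ι : Type*} [Fintype ι] {A : Fin n → Finset ι}
    (hA : IsAllocation A) : ∃ g : ι → Fin n, ∀ i, A i = univ.filter fun o => g o = i := by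
  choose g hg using hA.2
  refine ⟨g, fun i => ?_⟩
  ext o
  simp only [mem_filter, mem_univ, true_and]
  constructor
  · intro ho
    by_contra hne
    exact Finset.disjoint_left.mp (hA.1 _ _ hne) (hg o) ho
  · rintro rfl
    exact hg o

theorem SC_eq_sum_owner {n : ℕ} {ι : Type*} [Fintype ι] (c : Fin n → ι → ℝ)
    {A : Fin n → Finset ι} {g : ι → Fin n} (hg : ∀ i, A i = univ.filter fun o => g o = i) :
    SC c A = ∑ o, c (g o) o := by
  rw [SC, ← Finset.sum_fiberwise univ g (fun o => c (g o) o)]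
  refine Finset.sum_congr rfl fun i _ => ?_
  rw [hg]
  refine Finset.sum_congr rfl fun o ho => ?_
  rw [(mem_filter.mp ho).2]

/-- If every one of `m` parts is at least `T`, and together with a remainder they sum to `m * T`,
then every part equals `T` and the remainder vanishes. -/
theorem eq_of_le_of_sum_add_eq {m T r : ℕ} {s : Fin m → ℕ} (hs : ∀ i, T ≤ s i)
    (hsum : ∑ i, s i + r = m * T) : (∀ i, s i = T) ∧ r = 0 := by
  have hconst : ∑ _i : Fin m, T = m * T := by simp
  have hle : ∑ _i : Fin m, T ≤ ∑ i, s i := Finset.sum_le_sum fun i _ => hs i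
  have heq : ∑ _i : Fin m, T = ∑ i, s i := by omega
  exact ⟨fun i => ((Finset.sum_eq_sum_iff_of_le fun i _ => hs i).mp heq i (mem_univ i)).symm,
    by omega⟩

/-- Removing at most one chore from a bundle that contains two distinct chores of cost at least `T`
leaves a bundle of cost at least `T`. -/
theorem le_sum_sdiff_of_card_le_one {ι : Type*} [DecidableEq ι] {B S : Finset ι} {a b : ι}
    (hab : a ≠ b) (ha : a ∈ B) (hb : b ∈ B) (hS : S.card ≤ 1) (v : ι → ℕ) {T : ℕ}
    (hva : T ≤ v a) (hvb : T ≤ v b) : T ≤ ∑ o ∈ B \ S, v o := by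
  by_cases haS : a ∈ S
  · have hbS : b ∉ S := fun h => hab (Finset.card_le_one.mp hS a haS b h)
    exact hvb.trans (Finset.single_le_sum (fun _ _ => Nat.zero_le _) (mem_sdiff.mpr ⟨hb, hbS⟩))
  · exact hva.trans (Finset.single_le_sum (fun _ _ => Nat.zero_le _) (mem_sdiff.mpr ⟨ha, haS⟩))

section HardnessInstance

variable {m q T : ℕ} {p : Fin q → ℕ} {K : ℝ}

theorem cEF1H_last (o : Fin q ⊕ Fin 2) :
    cEF1H (m + 1) q T p K (Fin.last m) o =
      (2 * K + (m + 1 : ℕ) - 1) / (K * (m + 1 : ℕ) + K) *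
        (Sum.elim p (fun _ => T) o : ℕ) := by
  rcases o with j | k <;> simp [cEF1H]

theorem cEF1H_inl_of_ne_last {i : Fin (m + 1)} (hi : i ≠ Fin.last m) (j : Fin q) :
    cEF1H (m + 1) q T p K i (Sum.inl j) = p j / K := by
  have : (i : ℕ) ≠ m := fun h => hi (Fin.ext h)
  simp [cEF1H, this]

theorem cEF1H_inr_of_ne_last {i : Fin (m + 1)} (hi : i ≠ Fin.last m) (k : Fin 2) :
    cEF1H (m + 1) q T p K i (Sum.inr k) = T := by
  have : (i : ℕ) ≠ m := fun h => hi (Fin.ext h)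
  simp [cEF1H, this]

theorem alpha_le_one (hK : 1 ≤ K) :
    (2 * K + (m + 1 : ℕ) - 1) / (K * (m + 1 : ℕ) + K) ≤ 1 := by
  have hm : (0 : ℝ) ≤ m := m.cast_nonneg
  push_cast
  rw [div_le_one (by nlinarith)]
  nlinarith

theorem inv_le_alpha (hK : 1 ≤ K) :
    1 / K ≤ (2 * K + (m + 1 : ℕ) - 1) / (K * (m + 1 : ℕ) + K) := by
  have hm : (0 : ℝ) ≤ m := m.cast_nonneg
  push_cast
  rw [div_le_div_iff₀ (by linarith) (by nlinarith)]
  nlinarith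

theorem div_le_cEF1H_inl (hK : 1 ≤ K) (i : Fin (m + 1)) (j : Fin q) :
    p j / K ≤ cEF1H (m + 1) q T p K i (Sum.inl j) := by
  by_cases hi : i = Fin.last m
  · rw [hi, cEF1H_last, div_eq_mul_one_div, mul_comm]
    exact mul_le_mul_of_nonneg_right (inv_le_alpha hK) (Nat.cast_nonneg _)
  · exact (cEF1H_inl_of_ne_last hi j).ge

theorem alpha_mul_le_cEF1H_inr (hK : 1 ≤ K) (i : Fin (m + 1)) (k : Fin 2) :
    (2 * K + (m + 1 : ℕ) - 1) / (K * (m + 1 : ℕ) + K) * T ≤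
      cEF1H (m + 1) q T p K i (Sum.inr k) := by
  by_cases hi : i = Fin.last m
  · rw [hi, cEF1H_last, Sum.elim_inr]
  · rw [cEF1H_inr_of_ne_last hi]
    exact mul_le_of_le_one_left (Nat.cast_nonneg _) (alpha_le_one hK)

/-- If the last agent owns both large chores in an EF1 allocation, then the small chores can be
partitioned into parts of size `T`. -/
theorem exists_partition_of_EF1 (hp : ∀ j, 0 < p j) (hsum : ∑ j, p j = m * T) (hK : 1 ≤ K)
    {B : Fin (m + 1) → Finset (Fin q ⊕ Fin 2)} {g : Fin q ⊕ Fin 2 → Fin (m + 1)}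
    (hg : ∀ i, B i = univ.filter fun o => g o = i) (hB : EF1 (cEF1H (m + 1) q T p K) B)
    (hlast : ∀ k, g (Sum.inr k) = Fin.last m) :
    ∃ f : Fin q → Fin m, ∀ i, ∑ j ∈ univ.filter (fun j => f j = i), p j = T := by
  have hpart : ∀ i : Fin m,
      T ≤ ∑ j ∈ univ.filter (fun j => g (Sum.inl j) = i.castSucc), p j := by
    intro i
    obtain ⟨S, -, hS, hle⟩ := hB (Fin.last m) i.castSucc
    simp only [cEF1H_last, ← Finset.mul_sum] at hle
    have hα := lt_of_lt_of_le (by positivity) (inv_le_alpha (m := m) hK)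
    have hle' := le_of_mul_le_mul_left hle hα
    rw [← Nat.cast_sum, ← Nat.cast_sum, Nat.cast_le] at hle'
    have hmem : ∀ k, Sum.inr k ∈ B (Fin.last m) := fun k => by simp [hg, hlast]
    refine (le_sum_sdiff_of_card_le_one (a := Sum.inr 0) (b := Sum.inr 1) (by simp)
      (hmem 0) (hmem 1) hS _ le_rfl le_rfl).trans (hle'.trans ?_)
    simp [hg, Finset.sum_filter, Fintype.sum_sum_type, hlast, (Fin.castSucc_ne_last i).symm]
  have htotal : ∑ i : Fin m, ∑ j ∈ univ.filter (fun j => g (Sum.inl j) = i.castSucc), p j +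
      ∑ j ∈ univ.filter (fun j => g (Sum.inl j) = Fin.last m), p j = m * T := by
    rw [← hsum, ← Finset.sum_fiberwise univ (fun j => g (Sum.inl j)) p, Fin.sum_univ_castSucc]
  obtain ⟨heq, hzero⟩ := eq_of_le_of_sum_add_eq hpart htotal
  have hne : ∀ j, g (Sum.inl j) ≠ Fin.last m := fun j hj =>
    (hp j).ne' (Finset.sum_eq_zero_iff.mp hzero j (by simp [hj]))
  refine ⟨fun j => (g (Sum.inl j)).castPred (hne j), fun i => ?_⟩
  rw [← heq i]
  refine Finset.sum_congr (Finset.filter_congr fun j _ => ?_) fun _ _ => rfl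
  rw [Fin.castPred_eq_iff_eq_castSucc]

end HardnessInstance

theorem ef1_hardness_instance (n q T : ℕ) (hn : 3 ≤ n) (p : Fin q → ℕ)
    (hp : ∀ j, 0 < p j) (hsum : ∑ j, p j = (n - 1) * T) (K : ℝ) (hK : 1 ≤ K) :
    ((∀ f : Fin q → Fin (n - 1),
      (∀ i : Fin (n - 1), ∑ j ∈ Finset.univ.filter (fun j => f j = i), p j = T) →
      ∀ A : Fin n → Finset (Fin q ⊕ Fin 2), IsAllocation A →
        (∀ (i : Fin n) (h : (i : ℕ) < n - 1),
          A i = (Finset.univ.filter fun j => f j = (⟨(i : ℕ), h⟩ : Fin (n - 1))).image Sum.inl) →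
        A ⟨n - 1, by omega⟩ = {Sum.inr 0, Sum.inr 1} →
        EF1 (cEF1H n q T p K) A ∧
          SC (cEF1H n q T p K) A =
            ((n : ℝ) - 1) * T / K + 2 * ((2 * K + n - 1) / (K * n + K)) * T ∧
          (∀ B : Fin n → Finset (Fin q ⊕ Fin 2), IsAllocation B →
            SC (cEF1H n q T p K) A ≤ SC (cEF1H n q T p K) B))) ∧
    ((¬ ∃ f : Fin q → Fin (n - 1),
        ∀ i : Fin (n - 1), ∑ j ∈ Finset.univ.filter (fun j => f j = i), p j = T) →
      ∀ B : Fin n → Finset (Fin q ⊕ Fin 2), IsAllocation B → EF1 (cEF1H n q T p K) B →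
        ((n : ℝ) - 1) * T / K + (2 * K + n - 1) / (K * n + K) * T + T ≤
          SC (cEF1H n q T p K) B) := by
  obtain ⟨m, rfl⟩ : ∃ m, n = m + 1 := ⟨n - 1, by omega⟩
  simp only [Nat.add_sub_cancel] at hsum
  have hsumR : ∑ j, (p j : ℝ) / K = (((m + 1 : ℕ) : ℝ) - 1) * T / K := by
    rw [← Finset.sum_div, ← Nat.cast_sum, hsum]
    push_cast
    ring
  have hα : 1 / K ≤ (2 * K + (m + 1 : ℕ) - 1) / (K * (m + 1 : ℕ) + K) := inv_le_alpha hK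
  have hα1 : (2 * K + (m + 1 : ℕ) - 1) / (K * (m + 1 : ℕ) + K) ≤ 1 := alpha_le_one hK
  have hα0 := lt_of_lt_of_le (by positivity) hα
  have hT : (0 : ℝ) ≤ T := T.cast_nonneg
  refine ⟨?_, ?_⟩
  · intro f hf A hA hAi hAlast
    obtain ⟨g, hg⟩ := hA.exists_owner
    have hlast : ∀ k, g (Sum.inr k) = Fin.last m := by
      intro k
      have hmem : Sum.inr k ∈ A (Fin.last m) := by
        change A (Fin.last m) = _ at hAlast
        rw [hAlast]
        fin_cases k <;> simp
      simpa [hg] using hmem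
    have hsmall : ∀ i : Fin m, A i.castSucc = (univ.filter fun j => f j = i).image Sum.inl :=
      fun i => hAi i.castSucc i.isLt
    have hinl : ∀ j, g (Sum.inl j) ≠ Fin.last m := by
      intro j
      have hmem : Sum.inl j ∈ A (Fin.castSucc (f j)) := by simp [hsmall (f j)]
      have : g (Sum.inl j) = Fin.castSucc (f j) := by simpa [hg] using hmem
      rw [this]
      exact Fin.castSucc_ne_last _
    have hSC : SC (cEF1H (m + 1) q T p K) A = (((m + 1 : ℕ) : ℝ) - 1) * T / K +
        2 * ((2 * K + (m + 1 : ℕ) - 1) / (K * (m + 1 : ℕ) + K)) * T := by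
      rw [SC_eq_sum_owner _ hg, Fintype.sum_sum_type,
        Finset.sum_congr rfl fun j _ => cEF1H_inl_of_ne_last (hinl j) j, hsumR,
        Fin.sum_univ_two, hlast, hlast, cEF1H_last, cEF1H_last, Sum.elim_inr, Sum.elim_inr]
      ring
    refine ⟨?_, hSC, fun B hB => ?_⟩
    · have hcost : ∀ i k : Fin m, ∑ o ∈ A k.castSucc,
          cEF1H (m + 1) q T p K i.castSucc o = T / K := by
        intro i k
        rw [hsmall, Finset.sum_image fun _ _ _ _ h => Sum.inl_injective h,
          Finset.sum_congr rfl fun j _ => cEF1H_inl_of_ne_last (Fin.castSucc_ne_last i) j,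
          ← Finset.sum_div, ← Nat.cast_sum]
        exact congrArg (fun t : ℕ => (t : ℝ) / K) (hf k)
      have hlastBundle : A (Fin.last m) = {Sum.inr 0, Sum.inr 1} := hAlast
      intro i j
      induction i using Fin.lastCases with
      | cast i =>
        refine ⟨∅, by simp, by simp, ?_⟩
        rw [sdiff_empty, hcost]
        induction j using Fin.lastCases with
        | cast j => rw [hcost]
        | last =>
          rw [hlastBundle, Finset.sum_pair (by simp),
            cEF1H_inr_of_ne_last (Fin.castSucc_ne_last i),
            cEF1H_inr_of_ne_last (Fin.castSucc_ne_last i)]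
          linarith [div_le_self hT hK]
      | last =>
        refine ⟨{Sum.inr 1}, by simp [hlastBundle], by simp, ?_⟩
        have hrest : A (Fin.last m) \ {Sum.inr 1} = {Sum.inr 0} := by
          rw [hlastBundle]
          ext o
          rcases o with j | k
          · simp
          · fin_cases k <;> simp
        rw [hrest, Finset.sum_singleton, cEF1H_last, Sum.elim_inr]
        induction j using Fin.lastCases with
        | cast j =>
          rw [hsmall, Finset.sum_image fun _ _ _ _ h => Sum.inl_injective h]
          simp only [cEF1H_last, Sum.elim_inl, ← Finset.mul_sum, ← Nat.cast_sum]
          exact (congrArg (fun t : ℕ => _ * (t : ℝ)) (hf j)).ge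
        | last =>
          rw [hlastBundle, Finset.sum_pair (by simp), cEF1H_last, cEF1H_last, Sum.elim_inr,
            Sum.elim_inr]
          linarith [mul_nonneg hα0.le hT]
    · obtain ⟨b, hb⟩ := hB.exists_owner
      rw [hSC, SC_eq_sum_owner _ hb, Fintype.sum_sum_type, Fin.sum_univ_two, ← hsumR]
      have hle := Finset.sum_le_sum fun j (_ : j ∈ univ) =>
        div_le_cEF1H_inl (T := T) (p := p) hK (b (Sum.inl j)) j
      linarith [alpha_mul_le_cEF1H_inr (T := T) (p := p) hK (b (Sum.inr 0)) 0,
        alpha_mul_le_cEF1H_inr (T := T) (p := p) hK (b (Sum.inr 1)) 1]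
  · intro hno B hB hEF
    obtain ⟨b, hb⟩ := hB.exists_owner
    rw [SC_eq_sum_owner _ hb, Fintype.sum_sum_type, Fin.sum_univ_two, ← hsumR]
    have hle := Finset.sum_le_sum fun j (_ : j ∈ univ) =>
      div_le_cEF1H_inl (T := T) (p := p) hK (b (Sum.inl j)) j
    obtain ⟨k, hk⟩ : ∃ k, b (Sum.inr k) ≠ Fin.last m := by
      by_contra! hlast
      exact hno (exists_partition_of_EF1 hp hsum hK hb hEF hlast)
    have h0 := alpha_mul_le_cEF1H_inr (T := T) (p := p) hK (b (Sum.inr 0)) 0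
    have h1 := alpha_mul_le_cEF1H_inr (T := T) (p := p) hK (b (Sum.inr 1)) 1
    have hbig := cEF1H_inr_of_ne_last (T := T) (p := p) (K := K) hk k
    fin_cases k
    · change cEF1H (m + 1) q T p K (b (Sum.inr 0)) (Sum.inr 0) = T at hbig
      linarith
    · change cEF1H (m + 1) q T p K (b (Sum.inr 1)) (Sum.inr 1) = T at hbig
      linarith
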